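/- arXiv:1601.07404 — 2 statements merged into one kernel-verified Lean document; each statement's English description precedes it below -/
import Mathlib

section
/- Let (A,H,D,J) satisfy, for all a,b ∈ A: the order-zero condition [π(a), Jπ(b)J⁻¹] = 0 and the order-one condition [D,π(a)] J π(b) J⁻¹ = J π(b) J⁻¹ [D,π(a)]. Let k̃ ∈ A be invertible, k = π(k̃), k′ = J k J⁻¹, D_k = k′ D k′, and ν = k⁻¹k′ with ν̄(φ) = ν∘φ∘ν⁻¹. Then D_k satisfies the ν-twisted order-one condition: for all a,b ∈ A, J π(b) J⁻¹ [D_k, π(a)] = [D_k, π(a)] J ν̄²(π(b)) J⁻¹. -/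
/-- Conjugation of a linear endomorphism by an anti-linear bijection `J`:
`φ ↦ J ∘ φ ∘ J⁻¹`, which is again a linear endomorphism. -/
noncomputable def conjAL {H : Type*} [AddCommGroup H] [Module ℂ H]
    (J : H ≃ₗ⋆[ℂ] H) (φ : Module.End ℂ H) : Module.End ℂ H where
  toFun h := J (φ (J.symm h))
  map_add' x y := by simp
  map_smul' c x := by
    simp only [LinearEquiv.map_smulₛₗ, LinearMap.map_smulₛₗ, RingHom.id_apply,
      starRingEnd_apply, star_star, LinearMap.map_smul]

theorem conjAL_mul {H : Type*} [AddCommGroup H] [Module ℂ H]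
    (J : H ≃ₗ⋆[ℂ] H) (φ ψ : Module.End ℂ H) :
    conjAL J (φ * ψ) = conjAL J φ * conjAL J ψ := by
  ext h
  simp [conjAL]

theorem conjAL_one {H : Type*} [AddCommGroup H] [Module ℂ H] (J : H ≃ₗ⋆[ℂ] H) :
    conjAL J 1 = 1 := by
  ext h
  simp [conjAL]

/-- if `(A,H,D,J)` satisfies the order-zero and (untwisted) order-one
conditions, then `D_k = k′ D k′` (with `k = π(k̃)`, `k′ = J k J⁻¹`, `ν = k⁻¹k′`)
satisfies the `ν`-twisted order-one condition
`J π(b) J⁻¹ [D_k,π(a)] = [D_k,π(a)] J ν̄²(π(b)) J⁻¹`. -/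
theorem conformal_twisted_order_one
    {A H : Type*} [Ring A] [Algebra ℂ A] [StarRing A]
    [AddCommGroup H] [Module ℂ H]
    (π : A →ₐ[ℂ] Module.End ℂ H) (D : Module.End ℂ H) (J : H ≃ₗ⋆[ℂ] H)
    (hzero : ∀ a b : A, π a * conjAL J (π b) = conjAL J (π b) * π a)
    (hone : ∀ a b : A, (D * π a - π a * D) * conjAL J (π b)
        = conjAL J (π b) * (D * π a - π a * D))
    (kt : Aˣ)
    (k' Dk ν νinv : Module.End ℂ H)
    (hk' : k' = conjAL J (π (kt : A)))
    (hDk : Dk = k' * D * k')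
    (hν : ν = π (↑kt⁻¹ : A) * conjAL J (π (kt : A)))
    (hνinv : νinv = conjAL J (π (↑kt⁻¹ : A)) * π (kt : A)) :
    ∀ a b : A,
      conjAL J (π b) * (Dk * π a - π a * Dk)
        = (Dk * π a - π a * Dk) * conjAL J (ν * (ν * π b * νinv) * νinv) := by
  intro a b
  have conj_map_mul (x y : A) :
      conjAL J (π (x * y)) = conjAL J (π x) * conjAL J (π y) := by
    rw [map_mul, conjAL_mul]
  have mul_inv : conjAL J (π (kt : A)) * conjAL J (π (↑kt⁻¹ : A)) = 1 := by
    rw [← conj_map_mul, Units.mul_inv, map_one, conjAL_one]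
  have twist (x : A) : ν * π x * νinv = π (↑kt⁻¹ * x * kt) := by
    subst hν hνinv
    calc π (↑kt⁻¹ : A) * conjAL J (π (kt : A)) * π x *
          (conjAL J (π (↑kt⁻¹ : A)) * π (kt : A))
        = π (↑kt⁻¹ : A) * (conjAL J (π (kt : A)) * π x) *
          (conjAL J (π (↑kt⁻¹ : A)) * π (kt : A)) := by simp only [mul_assoc]
      _ = π (↑kt⁻¹ : A) * π x *
          (conjAL J (π (kt : A)) * conjAL J (π (↑kt⁻¹ : A))) * π (kt : A) := by
        rw [← hzero x kt]; simp only [mul_assoc]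
      _ = π (↑kt⁻¹ * x * kt) := by rw [mul_inv, mul_one, map_mul, map_mul]
  have commutator : Dk * π a - π a * Dk = k' * (D * π a - π a * D) * k' := by
    have h : π a * k' = k' * π a := hk' ▸ hzero a kt
    calc Dk * π a - π a * Dk
        = k' * D * (k' * π a) - (π a * k') * D * k' := by
          rw [hDk]; simp only [mul_assoc]
      _ = k' * (D * π a - π a * D) * k' := by
          rw [← h, mul_sub, sub_mul, h]; simp only [mul_assoc, h]
  rw [twist, twist, commutator, hk']
  generalize hT : D * π a - π a * D = T
  have order_one (x : A) : T * conjAL J (π x) = conjAL J (π x) * T := hT ▸ hone a x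
  calc conjAL J (π b) * (conjAL J (π (kt : A)) * T * conjAL J (π (kt : A)))
      = conjAL J (π (b * kt)) * T * conjAL J (π (kt : A)) := by
        rw [conj_map_mul]; simp only [mul_assoc]
    _ = T * conjAL J (π (b * kt * kt)) := by
        rw [← order_one, mul_assoc, ← conj_map_mul]
    _ = T * conjAL J (π (kt * (kt * (↑kt⁻¹ * (↑kt⁻¹ * b * kt) * kt)))) := by
        simp only [mul_assoc, Units.mul_inv_cancel_left]
    _ = conjAL J (π (kt : A)) * T * conjAL J (π (kt : A)) *
          conjAL J (π (↑kt⁻¹ * (↑kt⁻¹ * b * kt) * kt)) := by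
        rw [← order_one, conj_map_mul, conj_map_mul (kt : A)]; simp only [mul_assoc]
end

section
/- Let (A,H,D,J) satisfy the order-zero condition [π(a), Jπ(b)J⁻¹] = 0 for all a,b ∈ A and J D = ε′ D J for a sign ε′ ∈ {+1,−1}. Let k̃ ∈ A be invertible, k = π(k̃), k′ = J k J⁻¹, D_k = k′ D k′, and ν = k⁻¹k′. Then ν J D_k = ε′ D_k J ν. -/
section

variable {H : Type*} [AddCommGroup H] [Module ℂ H]

theorem conjAL_apply (J : H ≃ₗ⋆[ℂ] H) (φ : Module.End ℂ H) (h : H) :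
    conjAL J φ h = J (φ (J.symm h)) := rfl

/-- If `J² = ε` with `ε` a sign, then `J⁻¹ = ε J`. -/
theorem symm_apply_eq_sign_smul (J : H ≃ₗ⋆[ℂ] H) {ε : ℂ} (hε : ε = 1 ∨ ε = -1)
    (hJ2 : ∀ h : H, J (J h) = ε • h) (h : H) : J.symm h = ε • J h := by
  rw [LinearEquiv.symm_apply_eq, LinearEquiv.map_smulₛₗ, hJ2]
  rcases hε with rfl | rfl <;> simp

/-- If `J² = ±1`, then `J` intertwines `J φ J⁻¹` with `φ`. -/
theorem apply_conjAL (J : H ≃ₗ⋆[ℂ] H) {ε : ℂ} (hε : ε = 1 ∨ ε = -1)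
    (hJ2 : ∀ h : H, J (J h) = ε • h) (φ : Module.End ℂ H) (h : H) :
    J (conjAL J φ h) = φ (J h) := by
  rw [conjAL_apply, hJ2, symm_apply_eq_sign_smul J hε hJ2, map_smul, smul_smul]
  rcases hε with rfl | rfl <;> simp

/-- `J φ J⁻¹` composed with `J` is `J φ`. -/
theorem conjAL_apply_apply (J : H ≃ₗ⋆[ℂ] H) (φ : Module.End ℂ H) (h : H) :
    conjAL J φ (J h) = J (φ h) := by
  rw [conjAL_apply, LinearEquiv.symm_apply_apply]

end

/-- if the order-zero condition holds and `J D = ε′ D J`, then with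
`k = π(k̃)`, `k′ = J k J⁻¹`, `D_k = k′ D k′` and `ν = k⁻¹ k′`, one has
`ν J D_k = ε′ D_k J ν`. -/
theorem conformal_twisted_epsilon_condition
    {A H : Type*} [Ring A] [Algebra ℂ A] [StarRing A]
    [AddCommGroup H] [Module ℂ H]
    (π : A →ₐ[ℂ] Module.End ℂ H) (D : Module.End ℂ H) (J : H ≃ₗ⋆[ℂ] H)
    (ε ε' : ℂ) (hε : ε = 1 ∨ ε = -1) (hε' : ε' = 1 ∨ ε' = -1)
    (hJ2 : ∀ h : H, J (J h) = ε • h)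
    (hzero : ∀ a b : A, π a * conjAL J (π b) = conjAL J (π b) * π a)
    (hJD : ∀ h : H, J (D h) = ε' • D (J h))
    (kt : Aˣ)
    (k' Dk ν : Module.End ℂ H)
    (hk' : k' = conjAL J (π (kt : A)))
    (hDk : Dk = k' * D * k')
    (hν : ν = π (↑kt⁻¹ : A) * conjAL J (π (kt : A))) :
    ∀ h : H, ν (J (Dk h)) = ε' • Dk (J (ν h)) := by
  intro h
  have hcomm (x : H) : conjAL J (π kt) (π kt x) = π kt (conjAL J (π kt) x) :=
    (LinearMap.congr_fun (hzero kt kt) x).symm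
  have hinv_left (x : H) : π (↑kt⁻¹ : A) (π kt x) = x := by
    rw [← Module.End.mul_apply, ← map_mul, Units.inv_mul, map_one, Module.End.one_apply]
  have hinv_right (x : H) : π kt (π (↑kt⁻¹ : A) x) = x := by
    rw [← Module.End.mul_apply, ← map_mul, Units.mul_inv, map_one, Module.End.one_apply]
  subst hDk hν hk'
  simp only [Module.End.mul_apply]
  rw [apply_conjAL J hε hJ2, hJD, hcomm, hinv_left, conjAL_apply_apply, hinv_right, map_smul]
end
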